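/- Let v be a complete Llull matrix on a finite set A and let A = X ∪ Y be a partition into two disjoint nonempty sets. Then the following three conditions are equivalent: (i) v_{xy} = 1 for all x ∈ X and y ∈ Y; (ii) the indirect margin m*_{xy} = v*_{xy} − v*_{yx} equals 1 for all x ∈ X and y ∈ Y; (iii) the projected score v^π_{xy} equals 1 for all x ∈ X and y ∈ Y. -/

import Mathlib

/-! Common definitions: valued relations, indirect scores, admissible orders,
projected margins/scores, rank-like rates (Camps–Mora–Saumell CLC method). -/

variable {A : Type*} [Fintype A] [DecidableEq A]

/-- The score of a chain `x₀ :: x₁ :: ... :: xₙ`: the minimum of `v xᵢ xᵢ₊₁`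
over its links (value `1` for chains with no link, which we never use). -/
noncomputable def linkScore (v : A → A → ℝ) : List A → ℝ
  | [] => 1
  | [_] => 1
  | [a, b] => v a b
  | a :: b :: c :: l => min (v a b) (linkScore v (b :: c :: l))

/-- The indirect score `v*_{xy}`: the supremum (= maximum) of the scores of all
paths from `x` to `y` (with at least one link, consecutive elements distinct). -/
noncomputable def istar (v : A → A → ℝ) (x y : A) : ℝ :=
  sSup { s : ℝ | ∃ l : List A, List.Chain' (· ≠ ·) (x :: (l ++ [y])) ∧
      s = linkScore v (x :: (l ++ [y])) }

/-- `ξ` is a strict total order: irreflexive, transitive, total. -/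
def StrictTotal (ξ : A → A → Prop) : Prop :=
  (∀ x, ¬ ξ x x) ∧ (∀ x y z, ξ x y → ξ y z → ξ x z) ∧ (∀ x y, x ≠ y → ξ x y ∨ ξ y x)

/-- `ξ` is admissible for `v`: `v*_{xy} > v*_{yx}` implies `x` precedes `y`. -/
def Adm (v : A → A → ℝ) (ξ : A → A → Prop) : Prop :=
  ∀ x y, istar v x y > istar v y x → ξ x y

/-- Intermediate projected margin `m^σ_{xy}` (for `x` preceding `y` in `ξ`):
the infimum (= minimum) of the indirect margins `m*_{pq}` over `p ⪯ x`, `y ⪯ q`. -/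
noncomputable def msigma (v : A → A → ℝ) (ξ : A → A → Prop) (x y : A) : ℝ :=
  sInf { s : ℝ | ∃ p q, (ξ p x ∨ p = x) ∧ (ξ y q ∨ q = y) ∧
      s = istar v p q - istar v q p }

/-- `q` is the immediate successor of `p` in `ξ`. -/
def ImmSucc (ξ : A → A → Prop) (p q : A) : Prop :=
  ξ p q ∧ ∀ z, ¬ (ξ p z ∧ ξ z q)

/-- Projected margin (for `x` preceding `y` in `ξ`): the supremum (= maximum) of
`m^σ_{p p'}` over `x ⪯ p ≺ y`, `p'` the immediate successor of `p`. -/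
noncomputable def mpiAux (v : A → A → ℝ) (ξ : A → A → Prop) (x y : A) : ℝ :=
  sSup { s : ℝ | ∃ p q, (ξ x p ∨ p = x) ∧ ξ p y ∧ ImmSucc ξ p q ∧
      s = msigma v ξ p q }

open Classical in
/-- Projected margins `m^π`, extended antisymmetrically. -/
noncomputable def mpi (v : A → A → ℝ) (ξ : A → A → Prop) (x y : A) : ℝ :=
  if ξ x y then mpiAux v ξ x y else - mpiAux v ξ y x

/-- Projected scores `v^π_{xy} = (1 + m^π_{xy})/2`. -/
noncomputable def vpi (v : A → A → ℝ) (ξ : A → A → Prop) (x y : A) : ℝ :=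
  (1 + mpi v ξ x y) / 2

/-- Rank-like rate `R_x = N - ∑_{y ≠ x} v^π_{xy}`. -/
noncomputable def rlr (v : A → A → ℝ) (ξ : A → A → Prop) (x : A) : ℝ :=
  (Fintype.card A : ℝ) - ∑ y ∈ Finset.univ.erase x, vpi v ξ x y

/-- `v` is a complete Llull matrix: scores of distinct pairs lie in `[0,1]`
and satisfy `v_{xy} + v_{yx} = 1`. -/
def Llull (v : A → A → ℝ) : Prop :=
  ∀ x y : A, x ≠ y → 0 ≤ v x y ∧ v x y ≤ 1 ∧ v x y + v y x = 1

set_option linter.unusedSectionVars false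

theorem linkScore_cons (v : A → A → ℝ) (a x y : A) (l : List A) :
    linkScore v (x :: ((a :: l) ++ [y])) = min (v x a) (linkScore v (a :: (l ++ [y]))) := by
  cases l <;> rfl

theorem linkScore_mem_Icc {v : A → A → ℝ} (hv : Llull v) (l : List A) (x y : A)
    (h : List.IsChain (· ≠ ·) (x :: (l ++ [y]))) :
    0 ≤ linkScore v (x :: (l ++ [y])) ∧ linkScore v (x :: (l ++ [y])) ≤ 1 := by
  induction l generalizing x with
  | nil =>
    have hxy : x ≠ y := by simpa using h
    exact ⟨(hv x y hxy).1, (hv x y hxy).2.1⟩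
  | cons a l ih =>
    obtain ⟨hxa, hl⟩ := List.isChain_cons_cons.1 h
    rw [linkScore_cons]
    exact ⟨le_min (hv x a hxa).1 (ih a hl).1, (min_le_right _ _).trans (ih a hl).2⟩

/-- A path from `Y` to `X` contains a link from `Y` to `X`. -/
theorem linkScore_nonpos_of_crossing {v : A → A → ℝ} {X Y : Set A} (hcover : X ∪ Y = Set.univ)
    (h0 : ∀ y ∈ Y, ∀ x ∈ X, v y x ≤ 0) (l : List A) {y x : A} (hy : y ∈ Y) (hx : x ∈ X) :
    linkScore v (y :: (l ++ [x])) ≤ 0 := by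
  induction l generalizing y with
  | nil => exact h0 y hy x hx
  | cons a l ih =>
    rw [linkScore_cons]
    have ha : a ∈ X ∪ Y := hcover ▸ Set.mem_univ a
    rcases ha with ha | ha
    · exact (min_le_left _ _).trans (h0 y hy a ha)
    · exact (min_le_right _ _).trans (ih ha)

theorem istar_nonneg {v : A → A → ℝ} (hv : Llull v) (x y : A) : 0 ≤ istar v x y := by
  apply Real.sSup_nonneg
  rintro s ⟨l, hl, rfl⟩
  exact (linkScore_mem_Icc hv l x y hl).1

theorem istar_le_one {v : A → A → ℝ} (hv : Llull v) (x y : A) : istar v x y ≤ 1 := by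
  apply Real.sSup_le _ zero_le_one
  rintro s ⟨l, hl, rfl⟩
  exact (linkScore_mem_Icc hv l x y hl).2

theorem le_istar {v : A → A → ℝ} (hv : Llull v) {x y : A} (hxy : x ≠ y) :
    v x y ≤ istar v x y := by
  apply le_csSup
  · refine ⟨1, ?_⟩
    rintro s ⟨l, hl, rfl⟩
    exact (linkScore_mem_Icc hv l x y hl).2
  · exact ⟨[], List.isChain_pair.2 hxy, rfl⟩

theorem imargin_le_one {v : A → A → ℝ} (hv : Llull v) (x y : A) :
    istar v x y - istar v y x ≤ 1 := by
  linarith [istar_le_one hv x y, istar_nonneg hv y x]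

theorem eq_one_iff_imargin_eq_one {v : A → A → ℝ} (hv : Llull v) {X Y : Set A}
    (hdisj : Disjoint X Y) (hcover : X ∪ Y = Set.univ) :
    (∀ x ∈ X, ∀ y ∈ Y, v x y = 1) ↔
      ∀ x ∈ X, ∀ y ∈ Y, istar v x y - istar v y x = 1 := by
  constructor
  · intro h x hx y hy
    have hxy := hdisj.ne_of_mem hx hy
    have h0 : ∀ y ∈ Y, ∀ x ∈ X, v y x ≤ 0 := by
      intro y hy x hx
      linarith [(hv x y (hdisj.ne_of_mem hx hy)).2.2, h x hx y hy]
    have h1 : istar v y x ≤ 0 := by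
      apply Real.sSup_le _ le_rfl
      rintro s ⟨l, -, rfl⟩
      exact linkScore_nonpos_of_crossing hcover h0 l hy hx
    linarith [imargin_le_one hv x y, le_istar hv hxy, h x hx y hy]
  · intro h x hx y hy
    have hxy := hdisj.ne_of_mem hx hy
    linarith [h x hx y hy, istar_le_one hv x y, le_istar hv hxy.symm, (hv x y hxy).2.2,
      (hv x y hxy).2.1]

theorem exists_cut {ξ : A → A → Prop} (hξ : StrictTotal ξ) {X Y : Set A} (hX : X.Nonempty)
    (hY : Y.Nonempty) (hcover : X ∪ Y = Set.univ) (h : ∀ x ∈ X, ∀ y ∈ Y, ξ x y) :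
    ∃ x ∈ X, ∃ y ∈ Y, (∀ p, (ξ p x ∨ p = x) ↔ p ∈ X) ∧ (∀ q, (ξ y q ∨ q = y) ↔ q ∈ Y) := by
  obtain ⟨hirr, htrans, htot⟩ := hξ
  have : IsTrans A ξ := ⟨htrans⟩
  have : Std.Irrefl ξ := ⟨hirr⟩
  have : IsTrans A (Function.swap ξ) := ⟨fun a b c hab hbc => htrans c b a hbc hab⟩
  have : Std.Irrefl (Function.swap ξ) := ⟨hirr⟩
  obtain ⟨y, hy, hymin⟩ := (Finite.wellFounded_of_trans_of_irrefl ξ).has_min Y hY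
  obtain ⟨x, hx, hxmax⟩ :=
    (Finite.wellFounded_of_trans_of_irrefl (Function.swap ξ)).has_min X hX
  have hc : ∀ z, z ∈ X ∨ z ∈ Y := fun z => by
    have hz : z ∈ X ∪ Y := hcover ▸ Set.mem_univ z
    exact hz
  refine ⟨x, hx, y, hy, fun p => ⟨?_, fun hp => ?_⟩, fun q => ⟨?_, fun hq => ?_⟩⟩
  · rintro (hpx | rfl)
    · exact (hc p).resolve_right fun hp => hirr x (htrans _ _ _ (h x hx p hp) hpx)
    · exact hx
  · by_contra! hne
    exact ((htot p x hne.2).resolve_left hne.1 |> hxmax p hp)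
  · rintro (hyq | rfl)
    · exact (hc q).resolve_left fun hq => hirr y (htrans _ _ _ hyq (h q hq y hy))
    · exact hy
  · by_contra! hne
    exact ((htot q y hne.2).resolve_right hne.1 |> hymin q hq)

theorem imargin_nonneg {v : A → A → ℝ} {ξ : A → A → Prop} (hξ : StrictTotal ξ) (hadm : Adm v ξ)
    {p q : A} (hpq : ξ p q) : 0 ≤ istar v p q - istar v q p := by
  by_contra! hlt
  exact hξ.1 p (hξ.2.1 p q p hpq (hadm q p (by linarith)))

theorem zero_mem_lowerBounds_msigma {v : A → A → ℝ} {ξ : A → A → Prop} (hξ : StrictTotal ξ)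
    (hadm : Adm v ξ) {x y : A} (hxy : ξ x y) :
    0 ∈ lowerBounds { s : ℝ | ∃ p q, (ξ p x ∨ p = x) ∧ (ξ y q ∨ q = y) ∧
      s = istar v p q - istar v q p } := by
  rintro s ⟨p, q, hp, hq, rfl⟩
  apply imargin_nonneg hξ hadm
  have hpy : ξ p y := by
    rcases hp with hp | rfl
    · exact hξ.2.1 _ _ _ hp hxy
    · exact hxy
  rcases hq with hq | rfl
  · exact hξ.2.1 _ _ _ hpy hq
  · exact hpy

theorem msigma_nonneg {v : A → A → ℝ} {ξ : A → A → Prop} (hξ : StrictTotal ξ)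
    (hadm : Adm v ξ) {x y : A} (hxy : ξ x y) : 0 ≤ msigma v ξ x y :=
  Real.sInf_nonneg fun _ hs => zero_mem_lowerBounds_msigma hξ hadm hxy hs

theorem msigma_le_imargin {v : A → A → ℝ} {ξ : A → A → Prop} (hξ : StrictTotal ξ)
    (hadm : Adm v ξ) {x y p q : A} (hxy : ξ x y) (hp : ξ p x ∨ p = x) (hq : ξ y q ∨ q = y) :
    msigma v ξ x y ≤ istar v p q - istar v q p :=
  csInf_le ⟨0, zero_mem_lowerBounds_msigma hξ hadm hxy⟩ ⟨p, q, hp, hq, rfl⟩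

theorem mpiAux_nonneg {v : A → A → ℝ} {ξ : A → A → Prop} (hξ : StrictTotal ξ)
    (hadm : Adm v ξ) (x y : A) : 0 ≤ mpiAux v ξ x y := by
  apply Real.sSup_nonneg
  rintro s ⟨p, q, -, -, hpq, rfl⟩
  exact msigma_nonneg hξ hadm hpq.1

theorem msigma_le_one {v : A → A → ℝ} (hv : Llull v) {ξ : A → A → Prop} (hξ : StrictTotal ξ)
    (hadm : Adm v ξ) {x y : A} (hxy : ξ x y) : msigma v ξ x y ≤ 1 :=
  (msigma_le_imargin hξ hadm hxy (Or.inr rfl) (Or.inr rfl)).trans (imargin_le_one hv x y)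

theorem mpiAux_le_one {v : A → A → ℝ} (hv : Llull v) {ξ : A → A → Prop} (hξ : StrictTotal ξ)
    (hadm : Adm v ξ) (x y : A) : mpiAux v ξ x y ≤ 1 := by
  apply Real.sSup_le _ zero_le_one
  rintro s ⟨p, q, -, -, hpq, rfl⟩
  exact msigma_le_one hv hξ hadm hpq.1

theorem msigma_le_mpiAux {v : A → A → ℝ} (hv : Llull v) {ξ : A → A → Prop} (hξ : StrictTotal ξ)
    (hadm : Adm v ξ) {x y p q : A} (hp : ξ x p ∨ p = x) (hpy : ξ p y) (hpq : ImmSucc ξ p q) :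
    msigma v ξ p q ≤ mpiAux v ξ x y := by
  apply le_csSup
  · refine ⟨1, ?_⟩
    rintro s ⟨a, b, -, -, hab, rfl⟩
    exact msigma_le_one hv hξ hadm hab.1
  · exact ⟨p, q, hp, hpy, hpq, rfl⟩

theorem mpiAux_of_immSucc {v : A → A → ℝ} {ξ : A → A → Prop} (hξ : StrictTotal ξ) {x y : A}
    (hxy : ImmSucc ξ x y) : mpiAux v ξ x y = msigma v ξ x y := by
  have hset : { s : ℝ | ∃ p q, (ξ x p ∨ p = x) ∧ ξ p y ∧ ImmSucc ξ p q ∧ s = msigma v ξ p q } =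
      {msigma v ξ x y} := by
    ext s
    constructor
    · rintro ⟨p, q, hp | rfl, hpy, hpq, rfl⟩
      · exact absurd ⟨hp, hpy⟩ (hxy.2 p)
      · have : q = y := by
          by_contra hne
          rcases hξ.2.2 q y hne with hlt | hlt
          · exact hxy.2 q ⟨hpq.1, hlt⟩
          · exact hpq.2 y ⟨hxy.1, hlt⟩
        rw [this]
        rfl
    · rintro rfl
      exact ⟨x, y, Or.inr rfl, hxy.1, hxy, rfl⟩
  rw [mpiAux, hset, csSup_singleton]

theorem immSucc_of_cut {ξ : A → A → Prop} (hξ : StrictTotal ξ) {X Y : Set A}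
    (hcover : X ∪ Y = Set.univ) {x y : A} (hxy : ξ x y) (hx : ∀ p, (ξ p x ∨ p = x) ↔ p ∈ X)
    (hy : ∀ q, (ξ y q ∨ q = y) ↔ q ∈ Y) : ImmSucc ξ x y := by
  refine ⟨hxy, fun z ⟨hxz, hzy⟩ => ?_⟩
  have hz : z ∈ X ∪ Y := hcover ▸ Set.mem_univ z
  rcases hz with hz | hz
  · rcases (hx z).2 hz with hzx | rfl
    · exact hξ.1 _ (hξ.2.1 _ _ _ hxz hzx)
    · exact hξ.1 _ hxz
  · rcases (hy z).2 hz with hyz | rfl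
    · exact hξ.1 _ (hξ.2.1 _ _ _ hyz hzy)
    · exact hξ.1 _ hzy

theorem vpi_eq_one_iff {v : A → A → ℝ} {ξ : A → A → Prop} (hξ : StrictTotal ξ)
    (hadm : Adm v ξ) (x y : A) : vpi v ξ x y = 1 ↔ ξ x y ∧ mpiAux v ξ x y = 1 := by
  have h0 := mpiAux_nonneg hξ hadm y x
  unfold vpi mpi
  split_ifs with hxy
  · simp only [hxy, true_and]
    constructor <;> intro h <;> linarith
  · simp only [hxy, false_and, iff_false]
    intro h
    linarith

theorem imargin_eq_one_iff_vpi_eq_one {v : A → A → ℝ} (hv : Llull v) {X Y : Set A}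
    (hX : X.Nonempty) (hY : Y.Nonempty) (hcover : X ∪ Y = Set.univ) {ξ : A → A → Prop}
    (hξ : StrictTotal ξ) (hadm : Adm v ξ) :
    (∀ x ∈ X, ∀ y ∈ Y, istar v x y - istar v y x = 1) ↔
      ∀ x ∈ X, ∀ y ∈ Y, vpi v ξ x y = 1 := by
  simp only [vpi_eq_one_iff hξ hadm]
  constructor
  · intro h
    have hXY : ∀ x ∈ X, ∀ y ∈ Y, ξ x y := fun x hx y hy =>
      hadm x y (by linarith [h x hx y hy])
    obtain ⟨a, ha, b, hb, haX, hbY⟩ := exists_cut hξ hX hY hcover hXY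
    have hab := immSucc_of_cut hξ hcover (hXY a ha b hb) haX hbY
    have hone : 1 ≤ msigma v ξ a b := by
      apply le_csInf
      · exact ⟨_, a, b, Or.inr rfl, Or.inr rfl, rfl⟩
      · rintro s ⟨p, q, hp, hq, rfl⟩
        exact (h p ((haX p).1 hp) q ((hbY q).1 hq)).ge
    intro x hx y hy
    refine ⟨hXY x hx y hy, le_antisymm (mpiAux_le_one hv hξ hadm x y) (hone.trans ?_)⟩
    exact msigma_le_mpiAux hv hξ hadm (((haX x).2 hx).imp id Eq.symm) (hXY a ha y hy) hab
  · intro h x hx y hy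
    obtain ⟨a, ha, b, hb, haX, hbY⟩ :=
      exists_cut hξ hX hY hcover fun x hx y hy => (h x hx y hy).1
    have hab := (h a ha b hb).1
    have hone : msigma v ξ a b = 1 := by
      rw [← mpiAux_of_immSucc hξ (immSucc_of_cut hξ hcover hab haX hbY)]
      exact (h a ha b hb).2
    exact le_antisymm (imargin_le_one hv x y)
      (hone.ge.trans (msigma_le_imargin hξ hadm hab ((haX x).2 hx) ((hbY y).2 hy)))

/-- For a partition `A = X ∪ Y` into disjoint nonempty sets, the
following are equivalent: (i) `v_{xy} = 1` for all `x ∈ X`, `y ∈ Y`;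
(ii) `m*_{xy} = 1` for all such pairs; (iii) `v^π_{xy} = 1` for all such
pairs. -/
theorem stmt13 {A : Type*} [Fintype A] [DecidableEq A] (v : A → A → ℝ)
    (hv : Llull v) (X Y : Set A) (hX : X.Nonempty) (hY : Y.Nonempty)
    (hdisj : Disjoint X Y) (hcover : X ∪ Y = Set.univ)
    (ξ : A → A → Prop) (hξ : StrictTotal ξ) (hadm : Adm v ξ) :
    ((∀ x ∈ X, ∀ y ∈ Y, v x y = 1) ↔
      (∀ x ∈ X, ∀ y ∈ Y, istar v x y - istar v y x = 1)) ∧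
    ((∀ x ∈ X, ∀ y ∈ Y, v x y = 1) ↔
      (∀ x ∈ X, ∀ y ∈ Y, vpi v ξ x y = 1)) := by
  have h := eq_one_iff_imargin_eq_one hv hdisj hcover
  exact ⟨h, h.trans (imargin_eq_one_iff_vpi_eq_one hv hX hY hcover hξ hadm)⟩
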